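/- arXiv:1908.11294 — 2 statements merged into one kernel-verified Lean document; each statement's English description precedes it below -/
import Mathlib

section
/- Let n* be a real parameter with 0 < n* ≤ 0.7. Then the convex part of the single-well logarithmic potential, ψ₊(n) = -(1 - n*)·log(1 - n) - n³/3, is a convex function on the interval [0, 1). -/
/-- The convex part `ψ₊(n) = -(1 - n*)·log(1 - n) - n³/3` of the single-well
logarithmic potential is convex on `[0, 1)` whenever `0 < n* ≤ 0.7`. -/
theorem psi_plus_convexOn (nstar : ℝ) (h0 : 0 < nstar) (h1 : nstar ≤ 0.7) :
    ConvexOn ℝ (Set.Ico (0 : ℝ) 1)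
      (fun n : ℝ => -(1 - nstar) * Real.log (1 - n) - n ^ 3 / 3) := by
  have hlog : ∀ x : ℝ, x < 1 → HasDerivAt
      (fun n : ℝ => -(1 - nstar) * Real.log (1 - n) - n ^ 3 / 3)
      ((1 - nstar) * (1 - x)⁻¹ - x ^ 2) x := by
    intro x hx
    have hne : (1 - x) ≠ 0 := by linarith
    have h := ((((hasDerivAt_id x).const_sub 1).log hne).const_mul (-(1 - nstar))).sub
      ((hasDerivAt_pow 3 x).div_const 3)
    refine h.congr_deriv ?_
    simp only [id]
    field_simp
    norm_num
    try ring
  refine convexOn_of_hasDerivWithinAt2_nonneg (convex_Ico 0 1)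
    (f' := fun x => (1 - nstar) * (1 - x)⁻¹ - x ^ 2)
    (f'' := fun x => (1 - nstar) / (1 - x) ^ 2 - 2 * x) ?_ ?_ ?_ ?_
  · intro x hx
    exact (hlog x hx.2).continuousAt.continuousWithinAt
  · intro x hx
    exact (hlog x (interior_subset hx).2).hasDerivWithinAt
  · intro x hx
    have hx1 := (interior_subset hx).2
    have hne : (1 - x) ≠ 0 := by linarith
    have h := ((((hasDerivAt_id x).const_sub 1).inv hne).const_mul (1 - nstar)).sub
      (hasDerivAt_pow 2 x)
    refine HasDerivAt.hasDerivWithinAt (h.congr_deriv ?_)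
    simp only [id]
    field_simp
    norm_num
    try ring
  · intro x hx
    obtain ⟨hx0, hx1⟩ := interior_subset hx
    have hpos : 0 < (1 - x) ^ 2 := by
      have : 0 < 1 - x := by linarith
      positivity
    have key : 0 ≤ (x - 1 / 3) ^ 2 * (8 / 3 - 2 * x) :=
      mul_nonneg (sq_nonneg _) (by linarith)
    have : 2 * x ≤ (1 - nstar) / (1 - x) ^ 2 := by
      rw [le_div_iff₀ hpos]
      norm_num at h1
      nlinarith
    exact sub_nonneg.2 this
end

section
/- Let n* ∈ (0,1). The function ψ₊(n) = -(1 - n*)·log(1 - n) - n³/3 is convex on [0, 1) if and only if n* ≤ 19/27. -/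
lemma psi_aux_hasDeriv (a x : ℝ) (hx : x < 1) :
    HasDerivAt (fun n : ℝ => -a * Real.log (1 - n) - n ^ 3 / 3) (a / (1 - x) - x ^ 2) x := by
  have hne : (1 - x) ≠ 0 := by linarith
  have h := ((((hasDerivAt_id x).const_sub 1).log hne).const_mul (-a)).sub
    (((hasDerivAt_id x).pow 3).div_const 3)
  refine h.congr_deriv ?_
  simp only [id]
  field_simp
  norm_num
  try ring

lemma psi_aux_hasDeriv2 (a x : ℝ) (hx : x < 1) :
    HasDerivAt (fun n : ℝ => a / (1 - n) - n ^ 2) (a / (1 - x) ^ 2 - 2 * x) x := by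
  have hne : (1 - x) ≠ 0 := by linarith
  have h := ((hasDerivAt_const x a).div ((hasDerivAt_id x).const_sub 1) hne).sub
    ((hasDerivAt_id x).pow 2)
  refine h.congr_deriv ?_
  simp only [id]
  field_simp
  norm_num
  try ring

/-- For `n* ∈ (0,1)`, the function `ψ₊(n) = -(1 - n*)·log(1 - n) - n³/3`
is convex on `[0, 1)` if and only if `n* ≤ 19/27`. -/
theorem psi_plus_convexOn_iff (nstar : ℝ) (h0 : 0 < nstar) (h1 : nstar < 1) :
    ConvexOn ℝ (Set.Ico (0 : ℝ) 1)
      (fun n : ℝ => -(1 - nstar) * Real.log (1 - n) - n ^ 3 / 3)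
      ↔ nstar ≤ 19 / 27 := by
  constructor
  · intro hc
    by_contra hn
    push Not at hn
    obtain ⟨t, ht⟩ : ∃ t, t = nstar - 19 / 27 := ⟨_, rfl⟩
    have ht0 : 0 < t := by linarith
    have ht1 : t < 8 / 27 := by linarith
    have hx : (1 / 3 : ℝ) ∈ Set.Ico (0 : ℝ) 1 := by constructor <;> norm_num
    have hy : (1 / 3 + t : ℝ) ∈ Set.Ico (0 : ℝ) 1 := by constructor <;> linarith
    have hxy : (1 / 3 : ℝ) < 1 / 3 + t := by linarith
    have e1 := hc.le_slope_of_hasDerivAt hx hy hxy (psi_aux_hasDeriv _ _ hx.2)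
    have e2 := hc.slope_le_of_hasDerivAt hx hy hxy (psi_aux_hasDeriv _ _ hy.2)
    have e := e1.trans e2
    have hns : 1 - nstar = 8 / 27 - t := by linarith
    rw [hns] at e
    have hp : 0 < 1 - (1 / 3 + t) := by linarith
    have e3 : (8 / 27 - t) / (1 - 1 / 3) - (1 / 3) ^ 2 + (1 / 3 + t) ^ 2
        ≤ (8 / 27 - t) / (1 - (1 / 3 + t)) := by linarith
    rw [le_div_iff₀ hp] at e3
    have e4 : ((8 / 27 - t) / (1 - 1 / 3) - (1 / 3) ^ 2 + (1 / 3 + t) ^ 2) * (1 - (1 / 3 + t))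
        - (8 / 27 - t) = t * t * (3 / 2 - t) := by
      field_simp
      ring
    have e5 : 0 < t * t * (3 / 2 - t) := mul_pos (mul_pos ht0 ht0) (by linarith)
    linarith
  · intro hn
    refine convexOn_of_hasDerivWithinAt2_nonneg (convex_Ico 0 1)
      (f' := fun x => (1 - nstar) / (1 - x) - x ^ 2)
      (f'' := fun x => (1 - nstar) / (1 - x) ^ 2 - 2 * x) ?_ ?_ ?_ ?_
    · intro x hx
      exact (psi_aux_hasDeriv _ x hx.2).continuousAt.continuousWithinAt
    · intro x hx
      exact (psi_aux_hasDeriv _ x (interior_subset hx).2).hasDerivWithinAt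
    · intro x hx
      exact (psi_aux_hasDeriv2 _ x (interior_subset hx).2).hasDerivWithinAt
    · intro x hx
      obtain ⟨hx0, hx1⟩ := interior_subset hx
      have hp : 0 < (1 - x) ^ 2 := pow_pos (by linarith) 2
      rw [sub_nonneg, le_div_iff₀ hp]
      have : 8 / 27 - 2 * x * (1 - x) ^ 2 = 2 * (x - 1 / 3) ^ 2 * (4 / 3 - x) := by ring
      have h3 : 0 ≤ 2 * (x - 1 / 3) ^ 2 * (4 / 3 - x) :=
        mul_nonneg (by positivity) (by linarith)
      linarith
end
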